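/- arXiv:0710.5290 — 5 statements merged into one kernel-verified Lean document; each statement's English description precedes it below -/
import Mathlib

section
/- Let L be the free Lie algebra over a field K of characteristic zero on two generators e and f. Then the bigraded components L_{i,j} (over all pairs (i,j) of natural numbers) form an internal direct sum decomposition of L as a K-module: the submodules L_{i,j} span L and are independent (every element of L is uniquely a finite sum of components lying in the various L_{i,j}). -/
noncomputable section

namespace CMPaper

variable (K : Type*) [Field K] [CharZero K]

/-- The free Lie algebra on two generators. -/
abbrev L := FreeLieAlgebra K (Fin 2)

/-- The first generator `e`. -/
def e : L K := FreeLieAlgebra.of K (0 : Fin 2)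

/-- The second generator `f`. -/
def f : L K := FreeLieAlgebra.of K (1 : Fin 2)

/-- Iterated Lie bracket monomials in the generators in which `e` occurs exactly `i`
times and `f` occurs exactly `j` times. -/
inductive IsLieMonomial : L K → ℕ → ℕ → Prop
  | gen_e : IsLieMonomial (e K) 1 0
  | gen_f : IsLieMonomial (f K) 0 1
  | brak {x y : L K} {i j k l : ℕ} :
      IsLieMonomial x i j → IsLieMonomial y k l → IsLieMonomial ⁅x, y⁆ (i + k) (j + l)

/-- The bigraded component `L_{i,j}`: the `K`-span of the Lie monomials of bidegree `(i,j)`. -/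
def bihom (i j : ℕ) : Submodule K (L K) :=
  Submodule.span K {x : L K | IsLieMonomial K x i j}

/-- `L_{≥n,≥m}`: the submodule generated by all `L_{i,j}` with `i ≥ n`, `j ≥ m`. -/
def bihomGE (n m : ℕ) : Submodule K (L K) :=
  ⨆ (i : ℕ) (j : ℕ) (_ : n ≤ i) (_ : m ≤ j), bihom K i j

/-- The lower central series, normalized so that `lcs 1 = L` and `lcs (n+1) = ⁅L, lcs n⁆`. -/
def lcs (n : ℕ) : LieIdeal K (L K) := LieModule.lowerCentralSeries K (L K) (L K) (n - 1)

/-- The rescaling endomorphism `e ↦ 2e`, `f ↦ 3f`. -/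
def scaleHom : L K →ₗ⁅K⁆ L K :=
  FreeLieAlgebra.lift K (fun x : Fin 2 => if x = 0 then (2 : K) • e K else (3 : K) • f K)

theorem scaleHom_monomial {x : L K} {i j : ℕ} (h : IsLieMonomial K x i j) :
    scaleHom K x = ((2 : K) ^ i * 3 ^ j) • x := by
  induction h with
  | gen_e => simp [scaleHom, e]
  | gen_f => simp [scaleHom, f]
  | brak _ _ hx hy =>
    rw [LieHom.map_lie, hx, hy, smul_lie, lie_smul, smul_smul]
    congr 1
    ring

theorem bihom_le_eigenspace (i j : ℕ) :
    bihom K i j ≤ Module.End.eigenspace (scaleHom K : L K →ₗ[K] L K) ((2 : K) ^ i * 3 ^ j) := by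
  refine Submodule.span_le.2 fun x hx => ?_
  exact Module.End.mem_eigenspace_iff.2 (scaleHom_monomial K hx)

theorem two_three_injective :
    Function.Injective (fun p : ℕ × ℕ => (2 : K) ^ p.1 * 3 ^ p.2) := by
  rintro ⟨i, j⟩ ⟨k, l⟩ h
  have h' : 2 ^ i * 3 ^ j = 2 ^ k * 3 ^ l := by
    have : (((2 ^ i * 3 ^ j : ℕ)) : K) = ((2 ^ k * 3 ^ l : ℕ) : K) := by
      push_cast
      exact h
    exact_mod_cast this
  have h2 := congrArg (padicValNat 2) h'
  have h3 := congrArg (padicValNat 3) h'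
  have : Fact (Nat.Prime 3) := ⟨Nat.prime_three⟩
  have a1 : padicValNat 2 3 = 0 := padicValNat.eq_zero_of_not_dvd (by norm_num)
  have a2 : padicValNat 3 2 = 0 := padicValNat.eq_zero_of_not_dvd (by norm_num)
  have a3 : padicValNat 2 2 = 1 := padicValNat_self
  have a4 : padicValNat 3 3 = 1 := padicValNat_self
  rw [padicValNat.mul (by positivity) (by positivity),
    padicValNat.mul (by positivity) (by positivity)] at h2 h3
  simp only [padicValNat.pow, a1, a2, a3, a4] at h2 h3
  ext <;> simp <;> omega

theorem lie_mem_iSup {x y : L K} (hx : x ∈ ⨆ p : ℕ × ℕ, bihom K p.1 p.2)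
    (hy : y ∈ ⨆ p : ℕ × ℕ, bihom K p.1 p.2) : ⁅x, y⁆ ∈ ⨆ p : ℕ × ℕ, bihom K p.1 p.2 := by
  have key : (⨆ p : ℕ × ℕ, bihom K p.1 p.2) =
      Submodule.span K {x : L K | ∃ i j, IsLieMonomial K x i j} := by
    apply le_antisymm
    · exact iSup_le fun p => Submodule.span_mono fun x hx => ⟨p.1, p.2, hx⟩
    · refine Submodule.span_le.2 ?_
      rintro x ⟨i, j, hx⟩
      exact Submodule.mem_iSup_of_mem (i, j) (Submodule.subset_span hx)
  rw [key] at hx hy ⊢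
  induction hx using Submodule.span_induction with
  | zero => simp
  | add a b _ _ ha hb => rw [add_lie]; exact add_mem ha hb
  | smul t a _ ha => rw [smul_lie]; exact Submodule.smul_mem _ _ ha
  | mem a ha =>
    induction hy using Submodule.span_induction with
    | zero => simp
    | add a b _ _ ha hb => rw [lie_add]; exact add_mem ha hb
    | smul t a _ ha => rw [lie_smul]; exact Submodule.smul_mem _ _ ha
    | mem b hb =>
      obtain ⟨i, j, ha⟩ := ha
      obtain ⟨k, l, hb⟩ := hb
      exact Submodule.subset_span ⟨_, _, ha.brak hb⟩

/-- The sum of the bigraded components, as a Lie subalgebra. -/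
def sumSub : LieSubalgebra K (L K) :=
  { (⨆ p : ℕ × ℕ, bihom K p.1 p.2 : Submodule K (L K)) with
    lie_mem' := fun hx hy => lie_mem_iSup K hx hy }

theorem of_mem (x : Fin 2) : FreeLieAlgebra.of K x ∈ sumSub K := by
  change _ ∈ (⨆ p : ℕ × ℕ, bihom K p.1 p.2 : Submodule K (L K))
  fin_cases x
  · exact Submodule.mem_iSup_of_mem (1, 0) (Submodule.subset_span IsLieMonomial.gen_e)
  · exact Submodule.mem_iSup_of_mem (0, 1) (Submodule.subset_span IsLieMonomial.gen_f)

theorem iSup_bihom : (⨆ p : ℕ × ℕ, bihom K p.1 p.2) = ⊤ := by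
  refine eq_top_iff.2 fun x _ => ?_
  let g : L K →ₗ⁅K⁆ sumSub K := FreeLieAlgebra.lift K (fun x => ⟨_, of_mem K x⟩)
  have hg : (sumSub K).incl.comp g = LieHom.id := by
    ext x
    simp [g]
  have := LieHom.congr_fun hg x
  have h2 : ((g x : sumSub K) : L K) = x := this
  rw [← h2]
  exact (g x).2

/-- The bigraded components `L_{i,j}` form an internal direct sum decomposition of the
free Lie algebra on two generators, as a `K`-module. -/
theorem bigraded_isInternal :
    DirectSum.IsInternal (fun p : ℕ × ℕ => bihom K p.1 p.2) := by
  refine (DirectSum.isInternal_submodule_iff_iSupIndep_and_iSup_eq_top _).2 ⟨?_, iSup_bihom K⟩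
  exact ((Module.End.eigenspaces_iSupIndep (scaleHom K : L K →ₗ[K] L K)).comp
    (two_three_injective K)).mono fun p => bihom_le_eigenspace K p.1 p.2

end CMPaper
end
end

section
/- Let L be the free Lie algebra over a field K of characteristic zero on two generators e and f, with bigraded components L_{i,j}, and let L^n denote the n-th term of the lower central series of L, normalized so that L^1 = L. Then for every n ≥ 1, L^n equals the sum of the submodules L_{i,j} over all pairs (i,j) with i + j ≥ n. -/
noncomputable section

namespace CMPaper

variable (K : Type*) [Field K] [CharZero K]

/-- Sum of the components of total degree at least `n`. -/
def totGE (n : ℕ) : Submodule K (L K) := ⨆ (i : ℕ) (j : ℕ) (_ : n ≤ i + j), bihom K i j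

theorem mono_mem_totGE {x : L K} {i j n : ℕ} (hx : IsLieMonomial K x i j) (h : n ≤ i + j) :
    x ∈ totGE K n := by
  have h1 : x ∈ bihom K i j := Submodule.subset_span hx
  have h2 : bihom K i j ≤ totGE K n :=
    le_iSup_of_le i (le_iSup_of_le j (le_iSup_of_le h le_rfl))
  exact h2 h1

theorem totGE_le {n : ℕ} {p : Submodule K (L K)}
    (h : ∀ x i j, IsLieMonomial K x i j → n ≤ i + j → x ∈ p) : totGE K n ≤ p := by
  refine iSup_le fun i => iSup_le fun j => iSup_le fun hij => ?_
  exact Submodule.span_le.2 fun x hx => h x i j hx hij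

theorem lie_mem_totGE {a b : ℕ} {x y : L K} (hx : x ∈ totGE K a) (hy : y ∈ totGE K b) :
    ⁅x, y⁆ ∈ totGE K (a + b) := by
  have h1 : totGE K b ≤ (totGE K (a + b)).comap (LieModule.toEnd K (L K) (L K) x) := by
    refine totGE_le K fun y k l hy hkl => ?_
    have h2 : totGE K a ≤
        (totGE K (a + b)).comap ((LieModule.toEnd K (L K) (L K) : L K →ₗ[K] Module.End K (L K)).flip y) := by
      refine totGE_le K fun x i j hx hij => ?_
      exact mono_mem_totGE K (hx.brak hy) (by omega)
    exact h2 hx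
  exact h1 hy

theorem IsLieMonomial.pos {x : L K} {i j : ℕ} (hx : IsLieMonomial K x i j) : 1 ≤ i + j := by
  induction hx <;> omega

theorem totGE_one : totGE K 1 = ⊤ := by
  let S : LieSubalgebra K (L K) :=
    { totGE K 1 with
      lie_mem' := fun {x y} hx hy => by
        have h : totGE K (1 + 1) ≤ totGE K 1 :=
          totGE_le K fun x i j hx _ => mono_mem_totGE K hx hx.pos
        exact h (lie_mem_totGE K hx hy) }
  have hmem : ∀ t : Fin 2, FreeLieAlgebra.of K t ∈ S := by
    intro t
    fin_cases t
    · exact mono_mem_totGE K (.gen_e) le_rfl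
    · exact mono_mem_totGE K (.gen_f) le_rfl
  let g : L K →ₗ⁅K⁆ S := FreeLieAlgebra.lift K fun t => ⟨_, hmem t⟩
  have hg : S.incl.comp g = LieHom.id := by
    apply FreeLieAlgebra.hom_ext
    intro t
    simp [g]
  refine eq_top_iff.2 fun x _ => ?_
  have h := LieHom.congr_fun hg x
  have h2 : ((g x : S) : L K) = x := h
  rw [← h2]
  exact (g x).2

theorem lie_mem_lcs (a : ℕ) : ∀ x ∈ LieModule.lowerCentralSeries K (L K) (L K) a, ∀ b : ℕ,
    ∀ y ∈ LieModule.lowerCentralSeries K (L K) (L K) b,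
      ⁅x, y⁆ ∈ LieModule.lowerCentralSeries K (L K) (L K) (a + b + 1) := by
  induction a with
  | zero =>
    intro x _ b y hy
    rw [Nat.zero_add, LieModule.lowerCentralSeries_succ]
    exact LieSubmodule.lie_mem_lie (LieSubmodule.mem_top _) hy
  | succ a ih =>
    intro x hx b y hy
    rw [LieModule.lowerCentralSeries_succ, ← LieSubmodule.mem_toSubmodule,
      LieSubmodule.lieIdeal_oper_eq_linear_span'] at hx
    induction hx using Submodule.span_induction with
    | mem z hz =>
      obtain ⟨u, _, m, hm, rfl⟩ := hz
      rw [lie_lie]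
      refine sub_mem ?_ ?_
      · have h := ih m hm b y hy
        rw [show a + 1 + b + 1 = (a + b + 1) + 1 by omega, LieModule.lowerCentralSeries_succ]
        exact LieSubmodule.lie_mem_lie (LieSubmodule.mem_top _) h
      · have h : ⁅u, y⁆ ∈ LieModule.lowerCentralSeries K (L K) (L K) (b + 1) := by
          rw [LieModule.lowerCentralSeries_succ]
          exact LieSubmodule.lie_mem_lie (LieSubmodule.mem_top _) hy
        have h' := ih m hm (b + 1) _ h
        rwa [show a + 1 + b + 1 = a + (b + 1) + 1 by omega]
    | zero => simp
    | add p q _ _ hp hq => rw [add_lie]; exact add_mem hp hq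
    | smul c p _ hp => rw [smul_lie]; exact Submodule.smul_mem (LieSubmodule.toSubmodule _) c hp

theorem IsLieMonomial.mem_lcs {x : L K} {i j : ℕ} (hx : IsLieMonomial K x i j) :
    x ∈ LieModule.lowerCentralSeries K (L K) (L K) (i + j - 1) := by
  induction hx with
  | gen_e => simp
  | gen_f => simp
  | @brak x y i j k l hx hy h1 h2 =>
    have := hx.pos
    have := hy.pos
    rw [show i + k + (j + l) - 1 = (i + j - 1) + (k + l - 1) + 1 by omega]
    exact lie_mem_lcs K _ _ h1 _ _ h2

theorem lcs_le (n : ℕ) :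
    (LieModule.lowerCentralSeries K (L K) (L K) n).toSubmodule ≤ totGE K (n + 1) := by
  induction n with
  | zero => rw [Nat.zero_add, totGE_one]; exact le_top
  | succ n ih =>
    rw [LieModule.lowerCentralSeries_succ, LieSubmodule.lieIdeal_oper_eq_linear_span',
      Submodule.span_le]
    rintro _ ⟨u, _, m, hm, rfl⟩
    have hu : u ∈ totGE K 1 := by rw [totGE_one]; trivial
    have := lie_mem_totGE K hu (ih hm)
    rwa [add_comm 1] at this

/-- For every `n ≥ 1`, the `n`-th term of the lower central series is the sum of the
bigraded components `L_{i,j}` over all `(i,j)` with `i + j ≥ n`. -/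
theorem lcs_eq_sum_bihom (n : ℕ) (hn : 1 ≤ n) :
    (lcs K n : Submodule K (L K)) =
      ⨆ (i : ℕ) (j : ℕ) (_ : n ≤ i + j), bihom K i j := by
  change _ = totGE K n
  apply le_antisymm
  · have h := lcs_le K (n - 1)
    rwa [Nat.sub_add_cancel hn] at h
  · refine totGE_le K fun x i j hx hij => ?_
    exact LieModule.antitone_lowerCentralSeries K (L K) (L K) (Nat.sub_le_sub_right hij 1)
      hx.mem_lcs

end CMPaper
end
end

section
/- Let L be the free Lie algebra over a field K of characteristic zero on two generators e and f. Let φ : L → L be a Lie algebra endomorphism and a, b ∈ K scalars such that φ(e) − a•e ∈ L^2 and φ(f) − b•f ∈ L^2, where L^2 = ⁅L, L⁆. Then φ stabilizes every subspace L_{≥n,≥m}: for all natural numbers n, m, φ(L_{≥n,≥m}) ⊆ L_{≥n,≥m}. In particular, each L_{≥n,≥n} is stable under φ. -/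
noncomputable section

namespace CMPaper

variable (K : Type*) [Field K] [CharZero K]

theorem mono_mem {x : L K} {i j n m : ℕ} (h : IsLieMonomial K x i j) (hn : n ≤ i) (hm : m ≤ j) :
    x ∈ bihomGE K n m :=
  (le_iSup_of_le i <| le_iSup_of_le j <| le_iSup_of_le hn <| le_iSup_of_le hm le_rfl :
    bihom K i j ≤ bihomGE K n m) (Submodule.subset_span h)

theorem bihomGE_le {n m : ℕ} {P : Submodule K (L K)}
    (h : ∀ x i j, IsLieMonomial K x i j → n ≤ i → m ≤ j → x ∈ P) : bihomGE K n m ≤ P := by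
  refine iSup_le fun i => iSup_le fun j => iSup_le fun hn => iSup_le fun hm => ?_
  exact Submodule.span_le.2 fun x hx => h x i j hx hn hm

theorem bihomGE_anti {n m n' m' : ℕ} (hn : n' ≤ n) (hm : m' ≤ m) :
    bihomGE K n m ≤ bihomGE K n' m' :=
  bihomGE_le K fun _ _ _ h h1 h2 => mono_mem K h (hn.trans h1) (hm.trans h2)

theorem lie_mem_of_mono {P Q R : Submodule K (L K)} {n m n' m' : ℕ}
    (hP : P = bihomGE K n m) (hQ : Q = bihomGE K n' m')
    (h : ∀ x y i j k l, IsLieMonomial K x i j → IsLieMonomial K y k l → n ≤ i → m ≤ j →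
      n' ≤ k → m' ≤ l → ⁅x, y⁆ ∈ R) {x y : L K} (hx : x ∈ P) (hy : y ∈ Q) : ⁅x, y⁆ ∈ R := by
  subst hP hQ
  have h1 : bihomGE K n m ≤
      R.comap (LieModule.toEnd K (L K) (L K) y) := by
    refine bihomGE_le K fun x i j hx hi hj => ?_
    have h2 : bihomGE K n' m' ≤ R.comap (LieModule.toEnd K (L K) (L K) x) := by
      refine bihomGE_le K fun y k l hy hk hl => ?_
      exact h x y i j k l hx hy hi hj hk hl
    have h3 : ⁅x, y⁆ ∈ R := h2 hy
    have h4 : ⁅y, x⁆ ∈ R := by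
      rw [← lie_skew]
      exact neg_mem h3
    exact h4
  have h5 : ⁅y, x⁆ ∈ R := h1 hx
  rw [← lie_skew]
  exact neg_mem h5

theorem lie_mem_bihomGE {n m n' m' : ℕ} {x y : L K} (hx : x ∈ bihomGE K n m)
    (hy : y ∈ bihomGE K n' m') : ⁅x, y⁆ ∈ bihomGE K (n + n') (m + m') :=
  lie_mem_of_mono K rfl rfl (fun _ _ _ _ _ _ hx hy h1 h2 h3 h4 =>
    mono_mem K (hx.brak hy) (by omega) (by omega)) hx hy

theorem lie_mem_of_le {n m n' m' N M : ℕ} {x y : L K} (hx : x ∈ bihomGE K n m)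
    (hy : y ∈ bihomGE K n' m') (hN : N ≤ n + n') (hM : M ≤ m + m') : ⁅x, y⁆ ∈ bihomGE K N M :=
  bihomGE_anti K hN hM (lie_mem_bihomGE K hx hy)

theorem mem_zero (x : L K) : x ∈ bihomGE K 0 0 := by
  let S : LieSubalgebra K (L K) :=
    { bihomGE K 0 0 with
      lie_mem' := fun hx hy =>
        lie_mem_of_le K (n := 0) (m := 0) (n' := 0) (m' := 0) hx hy le_rfl le_rfl }
  have hS : ∀ i : Fin 2, FreeLieAlgebra.of K i ∈ S := by
    intro i
    fin_cases i
    · exact mono_mem K IsLieMonomial.gen_e (Nat.zero_le _) (Nat.zero_le _)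
    · exact mono_mem K IsLieMonomial.gen_f (Nat.zero_le _) (Nat.zero_le _)
  let F : L K →ₗ⁅K⁆ S := FreeLieAlgebra.lift K fun i => ⟨FreeLieAlgebra.of K i, hS i⟩
  have hF : S.incl.comp F = LieHom.id := by
    apply FreeLieAlgebra.hom_ext
    intro i
    simp [F]
  have : (S.incl.comp F) x = x := by rw [hF]; rfl
  rw [← this]
  exact (F x).2

theorem mono_cases {x : L K} {i j : ℕ} (h : IsLieMonomial K x i j) :
    x ∈ bihomGE K 1 1 ∨ x = e K ∨ x = f K := by
  induction h with
  | gen_e => exact Or.inr (Or.inl rfl)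
  | gen_f => exact Or.inr (Or.inr rfl)
  | @brak x y i j k l _ _ ihx ihy =>
    left
    rcases ihx with hx | hx
    · exact lie_mem_of_le K hx (mem_zero K y) (by omega) (by omega)
    rcases ihy with hy | hy
    · exact lie_mem_of_le K (mem_zero K x) hy (by omega) (by omega)
    rcases hx with rfl | rfl <;> rcases hy with rfl | rfl
    · rw [lie_self]; exact zero_mem _
    · exact mono_mem K (i := 1) (j := 1) (IsLieMonomial.brak (i := 1) (j := 0) (k := 0) (l := 1)
        IsLieMonomial.gen_e IsLieMonomial.gen_f) le_rfl le_rfl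
    · exact mono_mem K (i := 1) (j := 1) (IsLieMonomial.brak (i := 0) (j := 1) (k := 1) (l := 0)
        IsLieMonomial.gen_f IsLieMonomial.gen_e) le_rfl le_rfl
    · rw [lie_self]; exact zero_mem _

theorem lie_mem_one (x y : L K) : ⁅x, y⁆ ∈ bihomGE K 1 1 := by
  refine lie_mem_of_mono K rfl rfl (fun x y i j k l hx hy _ _ _ _ => ?_)
    (mem_zero K x) (mem_zero K y)
  rcases mono_cases K (hx.brak hy) with h | h
  · exact h
  rcases mono_cases K hx with hx | hx
  · exact lie_mem_of_le K hx (mem_zero K y) (by omega) (by omega)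
  rcases mono_cases K hy with hy | hy
  · exact lie_mem_of_le K (mem_zero K x) hy (by omega) (by omega)
  rcases hx with rfl | rfl <;> rcases hy with rfl | rfl
  · rw [lie_self]; exact zero_mem _
  · exact mono_mem K (i := 1) (j := 1) (IsLieMonomial.brak (i := 1) (j := 0) (k := 0) (l := 1)
        IsLieMonomial.gen_e IsLieMonomial.gen_f) le_rfl le_rfl
  · exact mono_mem K (i := 1) (j := 1) (IsLieMonomial.brak (i := 0) (j := 1) (k := 1) (l := 0)
        IsLieMonomial.gen_f IsLieMonomial.gen_e) le_rfl le_rfl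
  · rw [lie_self]; exact zero_mem _

theorem lcs_two_le {x : L K} (hx : x ∈ lcs K 2) : x ∈ bihomGE K 1 1 := by
  have hx' : x ∈ (⁅(⊤ : LieIdeal K (L K)), (⊤ : LieIdeal K (L K))⁆ : LieIdeal K (L K)) := by
    simpa [lcs, LieModule.lowerCentralSeries_succ] using hx
  rw [← LieSubmodule.mem_toSubmodule, LieSubmodule.lieIdeal_oper_eq_linear_span'] at hx'
  refine (Submodule.span_le.2 ?_) hx'
  rintro _ ⟨y, _, z, _, rfl⟩
  exact lie_mem_one K y z

/-- If a Lie algebra endomorphism `φ` satisfies `φ(e) ≡ a • e` and `φ(f) ≡ b • f`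
modulo `L² = ⁅L, L⁆`, then `φ` stabilizes every subspace `L_{≥n,≥m}`; in particular
each `L_{≥n,≥n}` is stable under `φ`. -/
theorem endo_stabilizes_bihomGE (φ : L K →ₗ⁅K⁆ L K) (a b : K)
    (he : φ (e K) - a • e K ∈ lcs K 2) (hf : φ (f K) - b • f K ∈ lcs K 2) :
    ∀ n m : ℕ, ∀ x ∈ bihomGE K n m, φ x ∈ bihomGE K n m := by
  have he' : φ (e K) ∈ bihomGE K 1 0 := by
    have h1 := bihomGE_anti K le_rfl (Nat.zero_le 1) (lcs_two_le K he)
    have h2 : a • e K ∈ bihomGE K 1 0 :=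
      Submodule.smul_mem _ _ (mono_mem K IsLieMonomial.gen_e le_rfl le_rfl)
    simpa using add_mem h1 h2
  have hf' : φ (f K) ∈ bihomGE K 0 1 := by
    have h1 := bihomGE_anti K (Nat.zero_le 1) le_rfl (lcs_two_le K hf)
    have h2 : b • f K ∈ bihomGE K 0 1 :=
      Submodule.smul_mem _ _ (mono_mem K IsLieMonomial.gen_f le_rfl le_rfl)
    simpa using add_mem h1 h2
  have key : ∀ x i j, IsLieMonomial K x i j → φ x ∈ bihomGE K i j := by
    intro x i j h
    induction h with
    | gen_e => exact he'
    | gen_f => exact hf'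
    | brak _ _ ihx ihy =>
      rw [LieHom.map_lie]
      exact lie_mem_bihomGE K ihx ihy
  intro n m x hx
  have h : bihomGE K n m ≤ (bihomGE K n m).comap (φ : L K →ₗ[K] L K) :=
    bihomGE_le K fun x i j h hi hj => bihomGE_anti K hi hj (key x i j h)
  exact h hx

end CMPaper
end
end

section
/- Let L be the free Lie algebra over a field K of characteristic zero on two generators e and f. Then for every n ≥ 3, the images of the two elements ad(e)^{n−2}(⁅e,f⁆) and ad(f)^{n−2}(⁅e,f⁆) in the quotient K-module L / (L^{n+1} + L_{≥2,≥2}) are linearly independent over K; in particular neither element lies in L^{n+1} + L_{≥2,≥2}. -/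
noncomputable section

namespace CMPaper

variable (K : Type*) [Field K] [CharZero K]

section Aux

attribute [local instance] LieRing.ofAssociativeRing

open Polynomial in
/-- Upper row matrices. -/
def mt (c : K) (p : K[X]) : Matrix (Fin 2) (Fin 2) K[X] := !![C c * X, p; 0, 0]

open Polynomial in
theorem mt_lie (c d : K) (p q : K[X]) :
    ⁅mt K c p, mt K d q⁆ = mt K 0 (X * (C c * q - C d * p)) := by
  rw [Ring.lie_def]
  refine Matrix.ext fun i j => ?_
  fin_cases i <;> fin_cases j <;> simp [mt, Matrix.mul_apply, Fin.sum_univ_two] <;> ring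

open Polynomial in
theorem mt_add (c d : K) (p q : K[X]) :
    mt K c p + mt K d q = mt K (c + d) (p + q) := by
  refine Matrix.ext fun i j => ?_
  fin_cases i <;> fin_cases j <;> simp [mt] <;> ring

open Polynomial in
theorem mt_smul (t c : K) (p : K[X]) :
    t • mt K c p = mt K (t * c) (C t * p) := by
  refine Matrix.ext fun i j => ?_
  fin_cases i <;> fin_cases j <;> simp [mt, Polynomial.smul_eq_C_mul] <;> ring

theorem mt_zero : mt K 0 0 = 0 := by
  refine Matrix.ext fun i j => ?_
  fin_cases i <;> fin_cases j <;> simp [mt]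

open Polynomial in
/-- The Lie subalgebra of all `mt c p`. -/
def mtSub : LieSubalgebra K (Matrix (Fin 2) (Fin 2) K[X]) where
  carrier := {M | ∃ c p, M = mt K c p}
  add_mem' := by
    rintro _ _ ⟨c, p, rfl⟩ ⟨d, q, rfl⟩
    exact ⟨_, _, mt_add K c d p q⟩
  zero_mem' := ⟨0, 0, (mt_zero K).symm⟩
  smul_mem' := by
    rintro t _ ⟨c, p, rfl⟩
    exact ⟨_, _, mt_smul K t c p⟩
  lie_mem' := by
    rintro _ _ ⟨c, p, rfl⟩ ⟨d, q, rfl⟩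
    exact ⟨_, _, mt_lie K c d p q⟩

open Polynomial in
/-- The images of the generators. -/
def gens (a i : Fin 2) : Matrix (Fin 2) (Fin 2) K[X] := if i = a then mt K 1 0 else mt K 0 1

open Polynomial in
/-- The representation sending generator `a` to `diag(X,0)` and the other one to `E₀₁`. -/
def phi (a : Fin 2) : L K →ₗ⁅K⁆ Matrix (Fin 2) (Fin 2) K[X] := FreeLieAlgebra.lift K (gens K a)

theorem phi_of (a i : Fin 2) : phi K a (FreeLieAlgebra.of K i) = gens K a i := by
  simp [phi]

theorem phi_form (a : Fin 2) (x : L K) : ∃ c p, phi K a x = mt K c p := by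
  have hg : ∀ i, gens K a i ∈ mtSub K := by
    intro i
    unfold gens
    split_ifs
    · exact ⟨_, _, rfl⟩
    · exact ⟨_, _, rfl⟩
  have h : phi K a = (mtSub K).incl.comp
      (FreeLieAlgebra.lift K (fun i => (⟨gens K a i, hg i⟩ : mtSub K))) := by
    apply FreeLieAlgebra.hom_ext
    intro i
    rw [phi_of, LieHom.comp_apply, FreeLieAlgebra.lift_of_apply]
    rfl
  rw [h]
  exact (FreeLieAlgebra.lift K (fun i => (⟨gens K a i, hg i⟩ : mtSub K)) x).2

open Polynomial in
theorem phi_lcs (a : Fin 2) (k : ℕ) : ∀ x ∈ LieModule.lowerCentralSeries K (L K) (L K) k,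
    ∃ c q, phi K a x = mt K c (X ^ k * q) ∧ (k = 0 ∨ c = 0) := by
  induction k with
  | zero =>
    intro x _
    obtain ⟨c, p, h⟩ := phi_form K a x
    exact ⟨c, p, by simpa using h, Or.inl rfl⟩
  | succ k ih =>
    intro x hx
    rw [LieModule.lowerCentralSeries_succ, ← LieSubmodule.mem_toSubmodule,
      LieSubmodule.lieIdeal_oper_eq_linear_span'] at hx
    suffices h : ∃ q, phi K a x = mt K 0 (X ^ (k + 1) * q) by
      obtain ⟨q, hq⟩ := h
      exact ⟨0, q, hq, Or.inr rfl⟩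
    induction hx using Submodule.span_induction with
    | mem x h =>
      obtain ⟨y, -, z, hz, rfl⟩ := h
      obtain ⟨c, p, h1⟩ := phi_form K a y
      obtain ⟨d, q, h2, h3⟩ := ih z hz
      rw [LieHom.map_lie, h1, h2, mt_lie]
      rcases h3 with rfl | rfl
      · exact ⟨C c * q - C d * p, by simp⟩
      · exact ⟨C c * q, by congr 1; simp; ring⟩
    | zero => exact ⟨0, by simp [mt_zero]⟩
    | add x y _ _ hx hy =>
      obtain ⟨p, hp⟩ := hx
      obtain ⟨q, hq⟩ := hy
      exact ⟨p + q, by rw [map_add, hp, hq, mt_add, mul_add, add_zero]⟩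
    | smul t x _ hx =>
      obtain ⟨p, hp⟩ := hx
      exact ⟨C t * p, by rw [map_smul, hp, mt_smul, mul_zero]; congr 1; ring⟩

theorem phi_mono (a : Fin 2) {x : L K} {i j : ℕ} (h : IsLieMonomial K x i j) :
    ∃ c p, phi K a x = mt K c p ∧ ((if a = 0 then j else i) ≠ 0 → c = 0) ∧
      ((if a = 0 then j else i) ≠ 1 → p = 0) := by
  induction h with
  | gen_e =>
    rw [e, phi_of]
    fin_cases a
    · exact ⟨1, 0, by simp [gens], by simp, by simp⟩
    · exact ⟨0, 1, by simp [gens], by simp, by simp⟩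
  | gen_f =>
    rw [f, phi_of]
    fin_cases a
    · exact ⟨0, 1, by simp [gens], by simp, by simp⟩
    · exact ⟨1, 0, by simp [gens], by simp, by simp⟩
  | @brak x y i j k l _ _ hx hy =>
    obtain ⟨c, p, h1, h2, h3⟩ := hx
    obtain ⟨d, q, h4, h5, h6⟩ := hy
    refine ⟨0, _, by rw [LieHom.map_lie, h1, h4, mt_lie], fun _ => rfl, ?_⟩
    have e1 : (if a = 0 then j + l else i + k) =
      (if a = 0 then j else i) + (if a = 0 then l else k) := by split_ifs <;> rfl
    rw [e1]
    generalize (if a = 0 then j else i) = u at *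
    generalize (if a = 0 then l else k) = v at *
    intro huv
    have hA : c = 0 ∨ q = 0 := by
      by_cases hu : u = 0
      · exact Or.inr (h6 (by omega))
      · exact Or.inl (h2 hu)
    have hB : d = 0 ∨ p = 0 := by
      by_cases hv : v = 0
      · exact Or.inr (h3 (by omega))
      · exact Or.inl (h5 hv)
    rcases hA with rfl | rfl <;> rcases hB with rfl | rfl <;> simp

open Polynomial in
/-- The functional. -/
def fn (a : Fin 2) (n : ℕ) : L K →ₗ[K] K :=
  (Polynomial.lcoeff K (n - 1)).comp
    ((Matrix.entryLinearMap K K[X] (0 : Fin 2) (1 : Fin 2)).comp (phi K a : L K →ₗ[K] _))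

open Polynomial in
theorem fn_of_mt (a : Fin 2) (n : ℕ) (x : L K) (c : K) (p : K[X]) (h : phi K a x = mt K c p) :
    fn K a n x = p.coeff (n - 1) := by
  simp [fn, h, mt]

theorem fn_ker (a : Fin 2) (n : ℕ) (hn : 3 ≤ n) :
    (lcs K (n + 1) : Submodule K (L K)) ⊔ bihomGE K 2 2 ≤ LinearMap.ker (fn K a n) := by
  apply sup_le
  · intro x hx
    obtain ⟨c, q, h, -⟩ := phi_lcs K a n x hx
    rw [LinearMap.mem_ker, fn_of_mt K a n x _ _ h, Polynomial.coeff_X_pow_mul']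
    rw [if_neg (by omega)]
  · refine iSup_le fun i => iSup_le fun j => iSup_le fun hi => iSup_le fun hj => ?_
    refine Submodule.span_le.2 fun x hx => ?_
    obtain ⟨c, p, h, -, h2⟩ := phi_mono K a hx
    have hp : p = 0 := h2 (by split_ifs <;> omega)
    change fn K a n x = 0
    rw [fn_of_mt K a n x _ _ h, hp, Polynomial.coeff_zero]

open Polynomial in
theorem phi_ad_same (a : Fin 2) (y : L K) (p : K[X]) (hy : phi K a y = mt K 0 p) (k : ℕ) :
    phi K a (((LieAlgebra.ad K (L K) (FreeLieAlgebra.of K a)) ^ k) y) = mt K 0 (X ^ k * p) := by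
  induction k with
  | zero => simpa using hy
  | succ k ih =>
    rw [pow_succ', Module.End.mul_apply, LieAlgebra.ad_apply, LieHom.map_lie, ih, phi_of, gens,
      if_pos rfl, mt_lie]
    congr 1
    simp
    ring

open Polynomial in
theorem phi_ad_diff (a b : Fin 2) (hab : b ≠ a) (y : L K) (p : K[X]) (hy : phi K a y = mt K 0 p)
    (k : ℕ) :
    phi K a (((LieAlgebra.ad K (L K) (FreeLieAlgebra.of K b)) ^ (k + 1)) y) = mt K 0 0 := by
  induction k with
  | zero =>
    rw [zero_add, pow_one, LieAlgebra.ad_apply, LieHom.map_lie, hy, phi_of, gens,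
      if_neg hab, mt_lie]
    simp
  | succ k ih =>
    rw [pow_succ', Module.End.mul_apply, LieAlgebra.ad_apply, LieHom.map_lie, ih, phi_of, gens,
      if_neg hab, mt_lie]
    simp

theorem phi_br0 : phi K 0 ⁅e K, f K⁆ = mt K 0 Polynomial.X := by
  rw [LieHom.map_lie, e, f, phi_of, phi_of, gens, gens, if_pos rfl, if_neg (by decide), mt_lie]
  simp

theorem phi_br1 : phi K 1 ⁅e K, f K⁆ = mt K 0 (-Polynomial.X) := by
  rw [LieHom.map_lie, e, f, phi_of, phi_of, gens, gens, if_neg (by decide), if_pos rfl, mt_lie]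
  simp

end Aux

/-- For `n ≥ 3`, the images of `ad(e)^{n-2}(⁅e,f⁆)` and `ad(f)^{n-2}(⁅e,f⁆)` in the
quotient `L / (L^{n+1} + L_{≥2,≥2})` are linearly independent over `K`; in particular
neither element lies in `L^{n+1} + L_{≥2,≥2}`. -/
theorem ad_images_linearIndependent (n : ℕ) (hn : 3 ≤ n) :
    LinearIndependent K
      ![(Submodule.Quotient.mk (((LieAlgebra.ad K (L K) (e K)) ^ (n - 2)) ⁅e K, f K⁆) :
          L K ⧸ ((lcs K (n + 1) : Submodule K (L K)) ⊔ bihomGE K 2 2)),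
        (Submodule.Quotient.mk (((LieAlgebra.ad K (L K) (f K)) ^ (n - 2)) ⁅e K, f K⁆) :
          L K ⧸ ((lcs K (n + 1) : Submodule K (L K)) ⊔ bihomGE K 2 2))] ∧
    ((LieAlgebra.ad K (L K) (e K)) ^ (n - 2)) ⁅e K, f K⁆ ∉
      (lcs K (n + 1) : Submodule K (L K)) ⊔ bihomGE K 2 2 ∧
    ((LieAlgebra.ad K (L K) (f K)) ^ (n - 2)) ⁅e K, f K⁆ ∉
      (lcs K (n + 1) : Submodule K (L K)) ⊔ bihomGE K 2 2 := by
  obtain ⟨m, rfl⟩ : ∃ m, n = m + 3 := ⟨n - 3, by omega⟩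
  have hk0 := fn_ker K 0 (m + 3) hn
  have hk1 := fn_ker K 1 (m + 3) hn
  have hn2 : m + 3 - 2 = m + 1 := by omega
  rw [hn2]
  have h0e : fn K 0 (m + 3) (((LieAlgebra.ad K (L K) (e K)) ^ (m + 1)) ⁅e K, f K⁆) = 1 := by
    refine (fn_of_mt K _ _ _ _ _ (phi_ad_same K 0 _ _ (phi_br0 K) (m + 1))).trans ?_
    rw [← pow_succ]
    simp
  have h0f : fn K 0 (m + 3) (((LieAlgebra.ad K (L K) (f K)) ^ (m + 1)) ⁅e K, f K⁆) = 0 := by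
    refine (fn_of_mt K _ _ _ _ _ (phi_ad_diff K 0 1 (by decide) _ _ (phi_br0 K) m)).trans ?_
    simp
  have h1e : fn K 1 (m + 3) (((LieAlgebra.ad K (L K) (e K)) ^ (m + 1)) ⁅e K, f K⁆) = 0 := by
    refine (fn_of_mt K _ _ _ _ _ (phi_ad_diff K 1 0 (by decide) _ _ (phi_br1 K) m)).trans ?_
    simp
  have h1f : fn K 1 (m + 3) (((LieAlgebra.ad K (L K) (f K)) ^ (m + 1)) ⁅e K, f K⁆) = -1 := by
    refine (fn_of_mt K _ _ _ _ _ (phi_ad_same K 1 _ _ (phi_br1 K) (m + 1))).trans ?_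
    rw [mul_neg, ← pow_succ]
    simp
  generalize ((LieAlgebra.ad K (L K) (e K)) ^ (m + 1)) ⁅e K, f K⁆ = x at *
  generalize ((LieAlgebra.ad K (L K) (f K)) ^ (m + 1)) ⁅e K, f K⁆ = y at *
  refine ⟨?_, ?_, ?_⟩
  · rw [LinearIndependent.pair_iff]
    intro s t hst
    rw [← Submodule.Quotient.mk_smul, ← Submodule.Quotient.mk_smul, ← Submodule.Quotient.mk_add,
      Submodule.Quotient.mk_eq_zero] at hst
    have h0 := LinearMap.mem_ker.1 (hk0 hst)
    have h1 := LinearMap.mem_ker.1 (hk1 hst)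
    rw [map_add, map_smul, map_smul, h0e, h0f] at h0
    rw [map_add, map_smul, map_smul, h1e, h1f] at h1
    constructor
    · simpa using h0
    · simpa using h1
  · intro h
    have h0 := LinearMap.mem_ker.1 (hk0 h)
    rw [h0e] at h0
    exact one_ne_zero h0
  · intro h
    have h1 := LinearMap.mem_ker.1 (hk1 h)
    rw [h1f] at h1
    exact neg_ne_zero.2 one_ne_zero h1

end CMPaper
end
end

section
/- Let L be the free Lie algebra over a field K of characteristic zero on two generators e and f. For every n ≥ 2, the element ad(e)^{n−2}(⁅e,f⁆) lies in the bigraded component L_{n−1,1} and in L^n, and the element ad(f)^{n−2}(⁅e,f⁆) lies in L_{1,n−1} and in L^n; for n ≥ 4 all other bigraded components L_{i,j} with i + j = n satisfy L_{i,j} ⊆ L_{≥2,≥2}. -/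
noncomputable section

namespace CMPaper

variable (K : Type*) [Field K] [CharZero K]

theorem mono_j0 {x : L K} {i j : ℕ} (h : IsLieMonomial K x i j) :
    j = 0 → x = 0 ∨ (x = e K ∧ i = 1) := by
  induction h with
  | gen_e => intro _; exact Or.inr ⟨rfl, rfl⟩
  | gen_f => intro h; omega
  | brak _ _ ih1 ih2 =>
    intro h
    left
    rcases ih1 (by omega) with h1 | ⟨h1, _⟩ <;> rcases ih2 (by omega) with h2 | ⟨h2, _⟩ <;>
      simp [h1, h2]

theorem mono_i0 {x : L K} {i j : ℕ} (h : IsLieMonomial K x i j) :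
    i = 0 → x = 0 ∨ (x = f K ∧ j = 1) := by
  induction h with
  | gen_f => intro _; exact Or.inr ⟨rfl, rfl⟩
  | gen_e => intro h; omega
  | brak _ _ ih1 ih2 =>
    intro h
    left
    rcases ih1 (by omega) with h1 | ⟨h1, _⟩ <;> rcases ih2 (by omega) with h2 | ⟨h2, _⟩ <;>
      simp [h1, h2]

theorem mono_e (m : ℕ) :
    IsLieMonomial K (((LieAlgebra.ad K (L K) (e K)) ^ m) ⁅e K, f K⁆) (m + 1) 1 := by
  induction m with
  | zero => exact .brak .gen_e .gen_f
  | succ m ih =>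
    rw [pow_succ', Module.End.mul_apply, LieAlgebra.ad_apply]
    have := IsLieMonomial.brak .gen_e ih
    rwa [Nat.zero_add, Nat.add_comm 1] at this

theorem mono_f (m : ℕ) :
    IsLieMonomial K (((LieAlgebra.ad K (L K) (f K)) ^ m) ⁅e K, f K⁆) 1 (m + 1) := by
  induction m with
  | zero => exact .brak .gen_e .gen_f
  | succ m ih =>
    rw [pow_succ', Module.End.mul_apply, LieAlgebra.ad_apply]
    have := IsLieMonomial.brak .gen_f ih
    rwa [Nat.zero_add, Nat.add_comm 1 (m + 1)] at this

theorem mem_lcs (x : L K) (m : ℕ) :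
    ((LieAlgebra.ad K (L K) x) ^ m) ⁅e K, f K⁆ ∈
      LieModule.lowerCentralSeries K (L K) (L K) (m + 1) := by
  induction m with
  | zero =>
    rw [LieModule.lowerCentralSeries_succ, LieModule.lowerCentralSeries_zero]
    exact LieSubmodule.lie_mem_lie (LieSubmodule.mem_top (e K)) (LieSubmodule.mem_top (f K))
  | succ m ih =>
    rw [pow_succ', Module.End.mul_apply, LieAlgebra.ad_apply,
      LieModule.lowerCentralSeries_succ]
    exact LieSubmodule.lie_mem_lie (LieSubmodule.mem_top _) ih

/-- For `n ≥ 2`, `ad(e)^{n-2}(⁅e,f⁆) ∈ L_{n-1,1} ∩ L^n` and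
`ad(f)^{n-2}(⁅e,f⁆) ∈ L_{1,n-1} ∩ L^n`; for `n ≥ 4`, every other bigraded component
`L_{i,j}` with `i + j = n` is contained in `L_{≥2,≥2}`. -/
theorem ad_powers_bidegree_and_rest :
    (∀ n : ℕ, 2 ≤ n →
      ((LieAlgebra.ad K (L K) (e K)) ^ (n - 2)) ⁅e K, f K⁆ ∈ bihom K (n - 1) 1 ∧
      ((LieAlgebra.ad K (L K) (e K)) ^ (n - 2)) ⁅e K, f K⁆ ∈ lcs K n ∧
      ((LieAlgebra.ad K (L K) (f K)) ^ (n - 2)) ⁅e K, f K⁆ ∈ bihom K 1 (n - 1) ∧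
      ((LieAlgebra.ad K (L K) (f K)) ^ (n - 2)) ⁅e K, f K⁆ ∈ lcs K n) ∧
    (∀ n : ℕ, 4 ≤ n → ∀ i j : ℕ, i + j = n →
      (i, j) ≠ (n - 1, 1) → (i, j) ≠ (1, n - 1) → bihom K i j ≤ bihomGE K 2 2) := by
  refine ⟨fun n hn => ?_, fun n hn i j hij h1 h2 => ?_⟩
  · obtain ⟨m, rfl⟩ := Nat.exists_eq_add_of_le' hn
    exact ⟨Submodule.subset_span (mono_e K m), mem_lcs K _ m,
      Submodule.subset_span (mono_f K m), mem_lcs K _ m⟩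
  · have h1' : j ≠ 1 := fun h => h1 (Prod.ext (by simp; omega) h)
    have h2' : i ≠ 1 := fun h => h2 (Prod.ext h (by simp; omega))
    by_cases hi : i = 0
    · refine Submodule.span_le.2 fun x hx => ?_
      rcases mono_i0 K hx hi with h | ⟨_, h⟩
      · rw [h]; exact Submodule.zero_mem _
      · omega
    by_cases hj : j = 0
    · refine Submodule.span_le.2 fun x hx => ?_
      rcases mono_j0 K hx hj with h | ⟨_, h⟩
      · rw [h]; exact Submodule.zero_mem _
      · omega
    exact le_iSup_of_le i (le_iSup_of_le j (le_iSup_of_le (by omega)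
      (le_iSup_of_le (by omega) le_rfl)))

end CMPaper
end
end
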